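/- arXiv:2501.15978 — 5 statements merged into one kernel-verified Lean document; each statement's English description precedes it below -/
import Mathlib

section
/- Let τ = (τ_R, τ_G, τ_B) be a square-tiled surface on {1,…,n} with profile (μ, k). Then 3n − k ≡ 2·Σ_{i≥1} μ_{2i} (mod 4). -/
/-! Common definitions: square-tiled surfaces as triples of involutions,
cylinder shears, profiles, etc. -/

inductive Color : Type
  | R | G | B
  deriving DecidableEq

/-- A candidate square-tiled surface on `Fin n`: a triple of permutations
indexed by the three colours. -/
abbrev Surf (n : ℕ) := Color → Equiv.Perm (Fin n)

/-- `f` is a square-tiled surface on `{1,…,n}` (`n ≥ 1`): the three permutations are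
involutions and the subgroup they generate acts transitively. -/
def IsSTS (n : ℕ) (f : Surf n) : Prop :=
  1 ≤ n ∧ (∀ X, f X * f X = 1) ∧
    ∀ x y : Fin n,
      ∃ p ∈ Subgroup.closure ({f Color.R, f Color.G, f Color.B} : Set (Equiv.Perm (Fin n))),
        p x = y

/-- Number of fixed points of a permutation of `Fin n`. -/
def fixedCount {n : ℕ} (π : Equiv.Perm (Fin n)) : ℕ :=
  (Finset.univ.filter fun x => π x = x).card

/-- Number of cycles of length `i` of `π`, fixed points counted as cycles of length 1. -/
def cycleCount {n : ℕ} (π : Equiv.Perm (Fin n)) (i : ℕ) : ℕ :=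
  if i = 1 then fixedCount π else Multiset.count i π.cycleType

/-- The product `τ_R · τ_G · τ_B`. -/
def prodRGB {n : ℕ} (f : Surf n) : Equiv.Perm (Fin n) :=
  f Color.R * f Color.G * f Color.B

/-- Total number of fixed points of the three permutations. -/
def totalFixed {n : ℕ} (f : Surf n) : ℕ :=
  fixedCount (f Color.R) + fixedCount (f Color.G) + fixedCount (f Color.B)

/-- `f` has profile `(μ, k)`: `μ i` is the number of cycles of length `i` of
`τ_R·τ_G·τ_B` (for `i ≥ 1`), and `k` is the total number of fixed points of the
three involutions. -/
def HasProfile {n : ℕ} (f : Surf n) (μ : ℕ → ℕ) (k : ℕ) : Prop :=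
  (∀ i, 1 ≤ i → cycleCount (prodRGB f) i = μ i) ∧ totalFixed f = k

open Classical in
/-- The permutation acting as `σ` on the (`σ`-invariant) set `c` and as the identity
outside of `c`. (Junk value `1` if `c` is not `σ`-invariant.) -/
noncomputable def restrictPerm {α : Type*} (σ : Equiv.Perm α) (c : Set α) : Equiv.Perm α :=
  if h : ∀ x, σ x ∈ c ↔ x ∈ c then
    { toFun := fun x => if x ∈ c then σ x else x
      invFun := fun x => if x ∈ c then σ.symm x else x
      left_inv := fun x => by
        by_cases hx : x ∈ c
        · simp [hx, (h x).mpr hx]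
        · simp [hx]
      right_inv := fun x => by
        by_cases hx : x ∈ c
        · have h1 : σ.symm x ∈ c := (h (σ.symm x)).mp (by simpa using hx)
          simp [hx, h1]
        · simp [hx] }
  else 1

/-- `c` is an `{i,j}`-component of `f`: an orbit of the subgroup generated by
`f i` and `f j`. -/
def IsComponent (n : ℕ) (f : Surf n) (i j : Color) (c : Set (Fin n)) : Prop :=
  ∃ x : Fin n,
    c = MulAction.orbit ↥(Subgroup.closure ({f i, f j} : Set (Equiv.Perm (Fin n)))) x

/-- The cylinder shear `Shear_{c,i,j}`: replace `f i` by `f i · c_i · c_j` and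
`f j` by `f j · c_i · c_j`, keeping the third permutation unchanged. -/
noncomputable def shear {n : ℕ} (f : Surf n) (i j : Color) (c : Set (Fin n)) : Surf n :=
  fun X =>
    if X = i ∨ X = j then f X * restrictPerm (f i) c * restrictPerm (f j) c else f X

/-- `m`-th power of the cylinder shear `Shear_{c,i,j}`. -/
noncomputable def shearPow {n : ℕ} (f : Surf n) (i j : Color) (c : Set (Fin n)) : ℕ → Surf n
  | 0 => f
  | m + 1 => shear (shearPow f i j c m) i j c

/-- The unordered pair `{i,j}` is `{R,G}` or `{G,B}`. -/
def GoodPair (i j : Color) : Prop :=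
  ({i, j} : Set Color) = {Color.R, Color.G} ∨ ({i, j} : Set Color) = {Color.G, Color.B}

/-- `A` (together with its complement) witnesses that `f` is Abelian. -/
def IsAbelianWitness (n : ℕ) (f : Surf n) (A : Set (Fin n)) : Prop :=
  A.Nonempty ∧ Aᶜ.Nonempty ∧ ∀ X : Color, (⇑(f X)) '' A = Aᶜ

/-- `f` is Abelian. -/
def IsAbelian (n : ℕ) (f : Surf n) : Prop :=
  ∃ A : Set (Fin n), IsAbelianWitness n f A

/-- `f` is path-like: `f G` and `f B` alone generate a transitive subgroup and have
exactly two fixed points in total. -/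
def IsPathLike (n : ℕ) (f : Surf n) : Prop :=
  (∀ x y : Fin n,
      ∃ p ∈ Subgroup.closure ({f Color.G, f Color.B} : Set (Equiv.Perm (Fin n))),
        p x = y) ∧
    fixedCount (f Color.G) + fixedCount (f Color.B) = 2

/-- `f` and `f'` are isomorphic square-tiled surfaces. -/
def Isomorphic (n : ℕ) (f f' : Surf n) : Prop :=
  ∃ σ : Equiv.Perm (Fin n), ∀ X, f' X = σ * f X * σ⁻¹

/-- One power of a cylinder shear. -/
def ShearPowStep (n : ℕ) (f f' : Surf n) : Prop :=
  ∃ (i j : Color) (c : Set (Fin n)) (m : ℕ),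
    GoodPair i j ∧ IsComponent n f i j c ∧ 1 ≤ m ∧ f' = shearPow f i j c m

/-- A sequence of `L` powers of cylinder shears from `f` to `f'`. -/
def ShearPowSeq (n : ℕ) : ℕ → Surf n → Surf n → Prop
  | 0, f, f' => f = f'
  | L + 1, f, f' => ∃ g, ShearPowStep n f g ∧ ShearPowSeq n L g f'

/-- A single vertical (i.e. `{R,G}`) cylinder shear. -/
def VertStep (n : ℕ) (f f' : Surf n) : Prop :=
  ∃ (i j : Color) (c : Set (Fin n)),
    ({i, j} : Set Color) = {Color.R, Color.G} ∧ IsComponent n f i j c ∧ f' = shear f i j c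

/-- A power of a horizontal (i.e. `{G,B}`) cylinder shear. -/
def HorizPowStep (n : ℕ) (f f' : Surf n) : Prop :=
  ∃ (i j : Color) (c : Set (Fin n)) (m : ℕ),
    ({i, j} : Set Color) = {Color.G, Color.B} ∧ IsComponent n f i j c ∧ 1 ≤ m ∧
      f' = shearPow f i j c m

/-- A sequence of `L` operations, each a single vertical shear or a power of a
horizontal shear. -/
def MixedSeq (n : ℕ) : ℕ → Surf n → Surf n → Prop
  | 0, f, f' => f = f'
  | L + 1, f, f' => ∃ g, (VertStep n f g ∨ HorizPowStep n f g) ∧ MixedSeq n L g f'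

/-- Profile `([2^{μ2}, 4g-2], 0)` (as far as the partition is concerned;
`totalFixed = 0` gives `k = 0`). -/
def ProfileA (n g μ2 : ℕ) (f : Surf n) : Prop :=
  totalFixed f = 0 ∧ cycleCount (prodRGB f) 2 = μ2 ∧
    cycleCount (prodRGB f) (4 * g - 2) = 1 ∧
    ∀ i, 1 ≤ i → i ≠ 2 → i ≠ 4 * g - 2 → cycleCount (prodRGB f) i = 0

/-- Profile `([2^{μ2}, (2g)^2], 0)`. -/
def ProfileB (n g μ2 : ℕ) (f : Surf n) : Prop :=
  totalFixed f = 0 ∧ cycleCount (prodRGB f) 2 = μ2 ∧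
    cycleCount (prodRGB f) (2 * g) = 2 ∧
    ∀ i, 1 ≤ i → i ≠ 2 → i ≠ 2 * g → cycleCount (prodRGB f) i = 0

/-- `α` is an automorphism of `f`. -/
def IsAut {n : ℕ} (f : Surf n) (α : Equiv.Perm (Fin n)) : Prop :=
  ∀ X, α * f X = f X * α

/-- `q` is (a presentation of) the quotient of `f` by the order-2 automorphism `α`:
there is a surjection `p` whose fibers are exactly the `⟨α⟩`-orbits and which
intertwines the permutations. -/
def IsQuotientBy (n m : ℕ) (f : Surf n) (α : Equiv.Perm (Fin n)) (q : Surf m) : Prop :=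
  ∃ p : Fin n → Fin m, Function.Surjective p ∧
    (∀ x y : Fin n, p x = p y ↔ (y = x ∨ y = α x)) ∧
    ∀ X x, p (f X x) = q X (p x)

/-- `4g - 4` where `g` is the genus of `f`, i.e. `Σ_i μ_i (i-2) - k`. -/
noncomputable def genusFour {n : ℕ} (f : Surf n) : ℤ :=
  (∑ i ∈ Finset.Icc 1 n, (cycleCount (prodRGB f) i : ℤ) * ((i : ℤ) - 2)) - (totalFixed f : ℤ)

/-- `α` is a hyperelliptic involution of `f`: an order-2 automorphism whose quotient
is a square-tiled surface of genus 0. -/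
def IsHyperInvolution {n : ℕ} (f : Surf n) (α : Equiv.Perm (Fin n)) : Prop :=
  IsAut f α ∧ α * α = 1 ∧ α ≠ 1 ∧
    ∃ (m : ℕ) (q : Surf m), IsSTS m q ∧ IsQuotientBy n m f α q ∧ genusFour q = -4

/-- `α` sends every point lying on a cycle of length `2g` of `τ_R·τ_G·τ_B` to a
different cycle (hence exchanges the two cycles of length `2g`). -/
def ExchangesTwoCycles {n : ℕ} (f : Surf n) (α : Equiv.Perm (Fin n)) (g : ℕ) : Prop :=
  ∀ x : Fin n, ((prodRGB f).cycleOf x).support.card = 2 * g →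
    ¬ (prodRGB f).SameCycle x (α x)

/-- Membership in `ST^hyp_Ab([2^{μ2}, 4g-2])`. -/
def InSTHypA (n g μ2 : ℕ) (f : Surf n) : Prop :=
  IsSTS n f ∧ IsAbelian n f ∧ ProfileA n g μ2 f ∧ ∃ α, IsHyperInvolution f α

/-- Membership in `ST^hyp_Ab([2^{μ2}, (2g)^2])`. -/
def InSTHypB (n g μ2 : ℕ) (f : Surf n) : Prop :=
  IsSTS n f ∧ IsAbelian n f ∧ ProfileB n g μ2 f ∧
    ∃ α, IsHyperInvolution f α ∧ ExchangesTwoCycles f α g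

theorem prod_map_neg_one_pow_eq_sum_count_even (n : ℕ) (m : Multiset ℕ)
    (hm : ∀ a ∈ m, 1 ≤ a ∧ a ≤ n) :
    (m.map fun a => -(-1 : ℤˣ) ^ a).prod =
      (-1) ^ ∑ i ∈ Finset.Icc 1 n, m.count (2 * i) := by
  induction m using Multiset.induction_on with
  | empty => simp
  | cons a s ih =>
    have ha := hm a (Multiset.mem_cons_self a s)
    simp only [Multiset.map_cons, Multiset.prod_cons, Multiset.count_cons,
      Finset.sum_add_distrib, pow_add]
    rw [ih fun b hb => hm b (Multiset.mem_cons_of_mem hb), mul_comm]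
    congr 1
    rcases Nat.even_or_odd' a with ⟨c, rfl | rfl⟩
    · have hc : ∀ i, (2 * i = 2 * c) = (i = c) := fun i => by simp
      have hmem : 1 ≤ c ∧ c ≤ n := by omega
      simp [hc, Finset.sum_ite_eq', hmem, pow_mul]
    · have hc : ∀ i, (2 * i = 2 * c + 1) = False := fun i => by simp; omega
      simp [hc, pow_add, pow_mul]

theorem sign_eq_neg_one_pow_sum_cycleCount {n : ℕ} (π : Equiv.Perm (Fin n)) :
    Equiv.Perm.sign π = (-1) ^ ∑ i ∈ Finset.Icc 1 n, cycleCount π (2 * i) := by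
  have hcount : ∀ i, cycleCount π (2 * i) = π.cycleType.count (2 * i) := fun i =>
    if_neg (by omega)
  simp only [hcount]
  rw [Equiv.Perm.sign_of_cycleType', prod_map_neg_one_pow_eq_sum_count_even n]
  intro a ha
  have h2 := Equiv.Perm.two_le_of_mem_cycleType ha
  have hle := Multiset.le_sum_of_mem ha
  have hsupp := π.support.card_le_univ
  rw [Equiv.Perm.sum_cycleType] at hle
  rw [Fintype.card_fin] at hsupp
  omega

theorem exists_fixedCount_add_two_mul_eq_of_mul_self_eq_one {n : ℕ} {σ : Equiv.Perm (Fin n)}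
    (hσ : σ * σ = 1) :
    ∃ m, fixedCount σ + 2 * m = n ∧ Equiv.Perm.sign σ = (-1) ^ m := by
  have hsq : σ ^ 2 = 1 := by rw [pow_two, hσ]
  have hrep := Equiv.Perm.cycleType_of_pow_prime_eq_one hsq
  have hsum := σ.sum_cycleType
  rw [hrep] at hsum
  have hcard := Finset.card_filter_add_card_filter_not (s := Finset.univ) (fun x => σ x = x)
  have hsupp : (Finset.univ.filter fun x => ¬ σ x = x) = σ.support := rfl
  rw [hsupp, ← hsum] at hcard
  refine ⟨σ.cycleType.card, ?_, ?_⟩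
  · simpa [fixedCount, mul_comm] using hcard
  · rw [Equiv.Perm.sign_of_cycleType', hrep]
    simp

/-- Let `τ` be a square-tiled surface on `{1,…,n}` with profile `(μ, k)`.
Then `3n - k ≡ 2·Σ_{i≥1} μ_{2i} (mod 4)`. -/
theorem stmt0 (n : ℕ) (τ : Surf n) (hτ : IsSTS n τ) (μ : ℕ → ℕ) (k : ℕ)
    (hprof : HasProfile τ μ k) :
    (3 * (n : ℤ) - (k : ℤ)) ≡ 2 * ∑ i ∈ Finset.Icc 1 n, (μ (2 * i) : ℤ) [ZMOD 4] := by
  obtain ⟨hμ, rfl⟩ := hprof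
  have hsum : ∑ i ∈ Finset.Icc 1 n, (μ (2 * i) : ℤ) =
      ((∑ i ∈ Finset.Icc 1 n, cycleCount (prodRGB τ) (2 * i) : ℕ) : ℤ) := by
    rw [Nat.cast_sum]
    refine Finset.sum_congr rfl fun i hi => ?_
    rw [hμ (2 * i) (by have := (Finset.mem_Icc.mp hi).1; omega)]
  obtain ⟨r, hr, hrs⟩ := exists_fixedCount_add_two_mul_eq_of_mul_self_eq_one (hτ.2.1 Color.R)
  obtain ⟨g, hg, hgs⟩ := exists_fixedCount_add_two_mul_eq_of_mul_self_eq_one (hτ.2.1 Color.G)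
  obtain ⟨b, hb, hbs⟩ := exists_fixedCount_add_two_mul_eq_of_mul_self_eq_one (hτ.2.1 Color.B)
  have hsign := sign_eq_neg_one_pow_sum_cycleCount (prodRGB τ)
  rw [hsum]
  generalize ∑ i ∈ Finset.Icc 1 n, cycleCount (prodRGB τ) (2 * i) = e at hsign ⊢
  rw [prodRGB, map_mul, map_mul, hrs, hgs, hbs, ← pow_add, ← pow_add] at hsign
  have hparity : Even (r + g + b + e) := by
    rw [← neg_one_pow_eq_one_iff_even (R := ℤˣ) (by decide), pow_add, hsign, ← pow_add,
      (Even.add_self e).neg_one_pow]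
  rw [Nat.even_iff] at hparity
  simp only [totalFixed, Int.ModEq]
  omega
end

section
/- Let τ be a square-tiled surface, let {i,j} be {R,G} or {G,B}, let c be an {i,j}-component of τ, and let τ' = Shear_{c,i,j}(τ). Then τ'_R·τ'_G·τ'_B = τ_R·τ_G·τ_B. -/
open Classical in
theorem restrictPerm_apply {α : Type*} {σ : Equiv.Perm α} {c : Set α}
    (h : ∀ x, σ x ∈ c ↔ x ∈ c) (x : α) :
    restrictPerm σ c x = if x ∈ c then σ x else x := by
  rw [restrictPerm, dif_pos h]
  rfl

theorem mem_orbit_closure_iff {α : Type*} {S : Set (Equiv.Perm α)} {σ : Equiv.Perm α}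
    (hσ : σ ∈ S) (x y : α) :
    σ y ∈ MulAction.orbit ↥(Subgroup.closure S) x ↔
      y ∈ MulAction.orbit ↥(Subgroup.closure S) x := by
  let g : ↥(Subgroup.closure S) := ⟨σ, Subgroup.subset_closure hσ⟩
  change g • y ∈ _ ↔ _
  rw [← MulAction.orbit_eq_iff, ← MulAction.orbit_eq_iff, MulAction.orbit_smul]

section
variable {α : Type*} {a b : Equiv.Perm α} {c : Set α}

/-- The two sheared involutions have the same product as the original ones. -/
theorem shear_mul_shear (ha : ∀ x, a x ∈ c ↔ x ∈ c) (hb : ∀ x, b x ∈ c ↔ x ∈ c)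
    (ha2 : a * a = 1) (hb2 : b * b = 1) :
    a * restrictPerm a c * restrictPerm b c * (b * restrictPerm a c * restrictPerm b c)
      = a * b := by
  have ha' (x : α) : a (a x) = x := DFunLike.congr_fun ha2 x
  have hb' (x : α) : b (b x) = x := DFunLike.congr_fun hb2 x
  ext x
  by_cases hx : x ∈ c <;>
    simp [restrictPerm_apply ha, restrictPerm_apply hb, ha, hb, hx, ha', hb']

/-- The product of the two sheared involutions is preserved in the opposite order as well. -/
theorem shear_mul_shear_swap (ha : ∀ x, a x ∈ c ↔ x ∈ c) (hb : ∀ x, b x ∈ c ↔ x ∈ c)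
    (ha2 : a * a = 1) (hb2 : b * b = 1) :
    b * restrictPerm a c * restrictPerm b c * (a * restrictPerm a c * restrictPerm b c)
      = b * a := by
  have ha' (x : α) : a (a x) = x := DFunLike.congr_fun ha2 x
  have hb' (x : α) : b (b x) = x := DFunLike.congr_fun hb2 x
  ext x
  by_cases hx : x ∈ c <;>
    simp [restrictPerm_apply ha, restrictPerm_apply hb, ha, hb, hx, ha', hb']

end

theorem GoodPair.cases {i j : Color} (h : GoodPair i j) :
    (i = .R ∧ j = .G) ∨ (i = .G ∧ j = .R) ∨ (i = .G ∧ j = .B) ∨ (i = .B ∧ j = .G) := by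
  rcases h with h | h <;> rcases Set.pair_eq_pair_iff.mp h with h | h <;> simp [h]

/-- A cylinder shear preserves the product `τ_R·τ_G·τ_B`. -/
theorem stmt1 (n : ℕ) (τ : Surf n) (hτ : IsSTS n τ) (i j : Color) (hij : GoodPair i j)
    (c : Set (Fin n)) (hc : IsComponent n τ i j c) :
    prodRGB (shear τ i j c) = prodRGB τ := by
  obtain ⟨x, hx⟩ := hc
  have hi (y : Fin n) : τ i y ∈ c ↔ y ∈ c := hx ▸ mem_orbit_closure_iff (by simp) x y
  have hj (y : Fin n) : τ j y ∈ c ↔ y ∈ c := hx ▸ mem_orbit_closure_iff (by simp) x y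
  have h := shear_mul_shear hi hj (hτ.2.1 i) (hτ.2.1 j)
  have h' := shear_mul_shear_swap hi hj (hτ.2.1 i) (hτ.2.1 j)
  rcases hij.cases with ⟨rfl, rfl⟩ | ⟨rfl, rfl⟩ | ⟨rfl, rfl⟩ | ⟨rfl, rfl⟩
  · simpa [prodRGB, shear] using h
  · simpa [prodRGB, shear] using h'
  · simpa [prodRGB, shear, mul_assoc] using h
  · simpa [prodRGB, shear, mul_assoc] using h'
end

section
/- Let τ be a square-tiled surface, let {i,j} be {R,G} or {G,B}, let c be an {i,j}-component of τ, and let τ' = Shear_{c,i,j}(τ). If a partition {1,…,n} = A_+ ⊔ A_− witnesses that τ is Abelian, then the same partition witnesses that τ' is Abelian. In particular, τ is Abelian if and only if τ' is Abelian. -/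
theorem isAbelianWitness_iff {n : ℕ} {f : Surf n} {A : Set (Fin n)} :
    IsAbelianWitness n f A ↔
      A.Nonempty ∧ Aᶜ.Nonempty ∧ ∀ (X : Color) (x : Fin n), f X x ∈ A ↔ x ∉ A := by
  have key (σ : Equiv.Perm (Fin n)) : σ '' A = Aᶜ ↔ ∀ x, σ x ∈ A ↔ x ∉ A := by
    constructor
    · intro h x
      have hx : σ x ∈ σ '' A ↔ x ∈ A := σ.injective.mem_set_image
      rw [h, Set.mem_compl_iff] at hx
      tauto
    · intro h
      ext y
      obtain ⟨x, rfl⟩ := σ.surjective y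
      rw [σ.injective.mem_set_image, Set.mem_compl_iff, h, not_not]
  simp only [IsAbelianWitness, key]

theorem IsComponent.apply_mem_iff {n : ℕ} {f : Surf n} {i j : Color} {c : Set (Fin n)}
    (hc : IsComponent n f i j c) {X : Color} (hX : X = i ∨ X = j) (x : Fin n) :
    f X x ∈ c ↔ x ∈ c := by
  obtain ⟨y, rfl⟩ := hc
  have hmem : f X ∈ Subgroup.closure ({f i, f j} : Set (Equiv.Perm (Fin n))) :=
    Subgroup.subset_closure (by rcases hX with rfl | rfl <;> simp)
  let g : Subgroup.closure ({f i, f j} : Set (Equiv.Perm (Fin n))) := ⟨f X, hmem⟩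
  change g • x ∈ _ ↔ _
  rw [← MulAction.orbit_eq_iff, MulAction.orbit_smul, MulAction.orbit_eq_iff]

theorem restrictPerm_apply_of_mem {α : Type*} {σ : Equiv.Perm α} {c : Set α}
    (h : ∀ x, σ x ∈ c ↔ x ∈ c) {x : α} (hx : x ∈ c) : restrictPerm σ c x = σ x := by
  simp [restrictPerm, h, hx]

theorem restrictPerm_apply_of_notMem {α : Type*} {σ : Equiv.Perm α} {c : Set α}
    {x : α} (hx : x ∉ c) : restrictPerm σ c x = x := by
  unfold restrictPerm
  split_ifs <;> simp [hx]

theorem shear_apply_of_ne {n : ℕ} {f : Surf n} {i j X : Color} (c : Set (Fin n))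
    (hX : ¬(X = i ∨ X = j)) : shear f i j c X = f X := if_neg hX

theorem shear_apply_of_notMem {n : ℕ} (f : Surf n) (i j X : Color) {c : Set (Fin n)}
    {x : Fin n} (hx : x ∉ c) : shear f i j c X x = f X x := by
  unfold shear
  split_ifs <;> simp [restrictPerm_apply_of_notMem hx]

theorem IsComponent.shear_apply_of_mem {n : ℕ} {f : Surf n} {i j X : Color}
    {c : Set (Fin n)} (hc : IsComponent n f i j c) (hX : X = i ∨ X = j) {x : Fin n}
    (hx : x ∈ c) : shear f i j c X x = f X (f i (f j x)) := by
  have hi := hc.apply_mem_iff (Or.inl rfl)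
  have hj := hc.apply_mem_iff (Or.inr rfl)
  simp only [shear, if_pos hX, Equiv.Perm.mul_apply, restrictPerm_apply_of_mem hj hx,
    restrictPerm_apply_of_mem hi ((hj x).mpr hx)]

theorem IsAbelianWitness.shear {n : ℕ} {f : Surf n} {i j : Color} {c A : Set (Fin n)}
    (hc : IsComponent n f i j c) (hA : IsAbelianWitness n f A) :
    IsAbelianWitness n (shear f i j c) A := by
  rw [isAbelianWitness_iff] at hA ⊢
  refine ⟨hA.1, hA.2.1, fun X x => ?_⟩
  have h := hA.2.2
  by_cases hX : X = i ∨ X = j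
  · by_cases hx : x ∈ c
    · rw [hc.shear_apply_of_mem hX hx, h, h, h, not_not]
    · rw [shear_apply_of_notMem f i j X hx, h]
  · rw [shear_apply_of_ne c hX, h]

theorem IsAbelianWitness.of_shear {n : ℕ} {f : Surf n} {i j : Color} {c A : Set (Fin n)}
    (hf : f i * f i = 1) (hc : IsComponent n f i j c)
    (hA : IsAbelianWitness n (_root_.shear f i j c) A) : IsAbelianWitness n f A := by
  rw [isAbelianWitness_iff] at hA ⊢
  refine ⟨hA.1, hA.2.1, fun X x => ?_⟩
  have h := hA.2.2
  by_cases hX : X = i ∨ X = j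
  · by_cases hx : x ∈ c
    · have hj : ∀ y ∈ c, (f j y ∈ A ↔ y ∉ A) := fun y hy => by
        have hinv : f i (f i (f j y)) = f j y := Equiv.congr_fun hf (f j y)
        rw [← h i y, hc.shear_apply_of_mem (Or.inl rfl) hy, hinv]
      rcases hX with rfl | rfl
      · obtain ⟨y, rfl⟩ := (f j).surjective x
        have hy : y ∈ c := (hc.apply_mem_iff (Or.inr rfl) y).mp hx
        have hjy := h j y
        rw [hc.shear_apply_of_mem (Or.inr rfl) hy,
          hj _ ((hc.apply_mem_iff (Or.inl rfl) _).mpr hx)] at hjy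
        have := hj y hy
        tauto
      · exact hj x hx
    · rw [← h X x, shear_apply_of_notMem f i j X hx]
  · rw [← h X x, shear_apply_of_ne c hX]

/-- A partition witnessing that `τ` is Abelian also witnesses that the
sheared surface is Abelian; in particular `τ` is Abelian iff its shear is. -/
theorem stmt3 (n : ℕ) (τ : Surf n) (hτ : IsSTS n τ) (i j : Color) (hij : GoodPair i j)
    (c : Set (Fin n)) (hc : IsComponent n τ i j c) :
    (∀ A : Set (Fin n), IsAbelianWitness n τ A → IsAbelianWitness n (shear τ i j c) A) ∧
      (IsAbelian n τ ↔ IsAbelian n (shear τ i j c)) := by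
  have hiff (A : Set (Fin n)) :
      IsAbelianWitness n τ A ↔ IsAbelianWitness n (shear τ i j c) A :=
    ⟨fun h => h.shear hc, fun h => h.of_shear (hτ.2.1 i) hc⟩
  exact ⟨fun A => (hiff A).mp, exists_congr hiff⟩
end

section
/- Let σ and ρ be involutions of a finite set S, and let c be an orbit of the subgroup generated by σ and ρ. Then the number of points of c fixed by σ plus the number of points of c fixed by ρ equals either 0 or 2. -/
/-- Among the residues `k` modulo `N`, the congruences `2 * k ≡ 0` and `2 * k + 1 ≡ 0` have two
solutions in total. -/
theorem card_dvd_two_mul_add_card_dvd_two_mul_add_one {N : ℕ} (hN : 0 < N) :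
    ((Finset.range N).filter fun k => N ∣ 2 * k).card +
      ((Finset.range N).filter fun k => N ∣ 2 * k + 1).card = 2 := by
  have key (a : ℕ) (ha : a < 2 * N) : N ∣ a ↔ a = 0 ∨ a = N := by
    constructor
    · rintro ⟨q, rfl⟩
      have hq : q < 2 := by
        rw [mul_comm 2 N] at ha
        exact Nat.lt_of_mul_lt_mul_left ha
      interval_cases q <;> simp
    · rintro (rfl | rfl) <;> simp
  obtain ⟨m, rfl | rfl⟩ := Nat.even_or_odd' N
  · have h₀ : ((Finset.range (2 * m)).filter fun k => 2 * m ∣ 2 * k) = {0, m} := by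
      ext k
      simp only [Finset.mem_filter, Finset.mem_range, Finset.mem_insert, Finset.mem_singleton]
      constructor
      · rintro ⟨hk, h⟩
        rw [key _ (by omega)] at h
        omega
      · intro h
        exact ⟨by omega, (key _ (by omega)).2 (by omega)⟩
    have h₁ : ((Finset.range (2 * m)).filter fun k => 2 * m ∣ 2 * k + 1) = ∅ := by
      ext k
      simp only [Finset.mem_filter, Finset.mem_range, Finset.notMem_empty, iff_false, not_and]
      intro hk h
      rw [key _ (by omega)] at h
      omega
    rw [h₀, h₁, Finset.card_pair (by omega), Finset.card_empty]
  · have h₀ : ((Finset.range (2 * m + 1)).filter fun k => 2 * m + 1 ∣ 2 * k) = {0} := by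
      ext k
      simp only [Finset.mem_filter, Finset.mem_range, Finset.mem_singleton]
      constructor
      · rintro ⟨hk, h⟩
        rw [key _ (by omega)] at h
        omega
      · intro h
        exact ⟨by omega, (key _ (by omega)).2 (by omega)⟩
    have h₁ : ((Finset.range (2 * m + 1)).filter fun k => 2 * m + 1 ∣ 2 * k + 1) = {m} := by
      ext k
      simp only [Finset.mem_filter, Finset.mem_range, Finset.mem_singleton]
      constructor
      · rintro ⟨hk, h⟩
        rw [key _ (by omega)] at h
        omega
      · intro h
        exact ⟨by omega, (key _ (by omega)).2 (by omega)⟩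
    rw [h₀, h₁, Finset.card_singleton, Finset.card_singleton]

section Involutions

variable {S : Type*} {σ ρ : Equiv.Perm S} {y : S}

theorem involution_mul_zpow_apply (hσ : σ * σ = 1) (hρ : ρ * ρ = 1) (hy : σ y = y) (k : ℤ) :
    σ (((σ * ρ) ^ k) y) = ((σ * ρ) ^ (-k)) y := by
  have hσ' : σ⁻¹ = σ := inv_eq_of_mul_eq_one_left hσ
  have hρ' : ρ⁻¹ = ρ := inv_eq_of_mul_eq_one_left hρ
  have h : σ * (σ * ρ) ^ k * σ⁻¹ = (σ * ρ) ^ (-k) := by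
    rw [← conj_zpow, zpow_neg, ← inv_zpow, mul_inv_rev, hσ', hρ', ← mul_assoc, hσ, one_mul]
  rw [← h, hσ', Equiv.Perm.mul_apply, Equiv.Perm.mul_apply, hy]

theorem involution_mul_zpow_apply' (hσ : σ * σ = 1) (hρ : ρ * ρ = 1) (hy : σ y = y) (k : ℤ) :
    ρ (((σ * ρ) ^ k) y) = ((σ * ρ) ^ (-k - 1)) y := by
  have h : ρ = σ * (σ * ρ) := by rw [← mul_assoc, hσ, one_mul]
  calc ρ (((σ * ρ) ^ k) y) = σ (((σ * ρ) ^ (1 + k)) y) := by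
        rw [zpow_one_add, ← Equiv.Perm.mul_apply, ← Equiv.Perm.mul_apply, ← mul_assoc σ, ← h]
    _ = _ := by
        rw [involution_mul_zpow_apply hσ hρ hy]
        congr 2
        ring

theorem mem_orbit_closure_pair_iff (hσ : σ * σ = 1) (hρ : ρ * ρ = 1) (hy : σ y = y) (z : S) :
    z ∈ MulAction.orbit (Subgroup.closure ({σ, ρ} : Set (Equiv.Perm S))) y ↔
      ∃ k : ℤ, ((σ * ρ) ^ k) y = z := by
  have hσ' : σ⁻¹ = σ := inv_eq_of_mul_eq_one_left hσ
  have hρ' : ρ⁻¹ = ρ := inv_eq_of_mul_eq_one_left hρ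
  constructor
  · rintro ⟨⟨g, hg⟩, rfl⟩
    change ∃ k : ℤ, ((σ * ρ) ^ k) y = g y
    have step : ∀ s ∈ ({σ, ρ} : Set (Equiv.Perm S)), ∀ k : ℤ,
        ∃ l : ℤ, ((σ * ρ) ^ l) y = s (((σ * ρ) ^ k) y) := by
      rintro s (rfl | rfl) k
      · exact ⟨_, (involution_mul_zpow_apply hσ hρ hy k).symm⟩
      · exact ⟨_, (involution_mul_zpow_apply' hσ hρ hy k).symm⟩
    induction hg using Subgroup.closure_induction_left with
    | one => exact ⟨0, rfl⟩
    | mul_left s hs g _ ih =>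
      obtain ⟨k, hk⟩ := ih
      rw [Equiv.Perm.mul_apply, ← hk]
      exact step s hs k
    | inv_mul_cancel s hs g _ ih =>
      obtain ⟨k, hk⟩ := ih
      have hs' : s⁻¹ = s := by
        obtain rfl | rfl := hs
        exacts [hσ', hρ']
      rw [Equiv.Perm.mul_apply, ← hk, hs']
      exact step s hs k
  · rintro ⟨k, rfl⟩
    have hmem : (σ * ρ) ^ k ∈ Subgroup.closure ({σ, ρ} : Set (Equiv.Perm S)) :=
      zpow_mem (mul_mem (Subgroup.subset_closure (by simp)) (Subgroup.subset_closure (by simp))) k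
    exact ⟨⟨_, hmem⟩, rfl⟩

theorem ncard_fixed_add_ncard_fixed_of_fixed [Finite S] (hσ : σ * σ = 1) (hρ : ρ * ρ = 1)
    (hy : σ y = y) {c : Set S}
    (hc : c = MulAction.orbit (Subgroup.closure ({σ, ρ} : Set (Equiv.Perm S))) y) :
    {z ∈ c | σ z = z}.ncard + {z ∈ c | ρ z = z}.ncard = 2 := by
  set τ := σ * ρ
  set N := Function.minimalPeriod (τ • ·) y
  have hdvd (n : ℤ) : (τ ^ n) y = y ↔ (N : ℤ) ∣ n :=
    MulAction.zpow_smul_eq_iff_minimalPeriod_dvd (a := τ) (b := y) (n := n)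
  have heq (a b : ℤ) : (τ ^ a) y = (τ ^ b) y ↔ (N : ℤ) ∣ b - a := by
    rw [← hdvd, sub_eq_neg_add, zpow_add, Equiv.Perm.mul_apply, zpow_neg, Equiv.Perm.inv_eq_iff_eq,
      eq_comm]
  have hpos : 0 < N := by
    refine Nat.pos_of_ne_zero fun h0 => ?_
    have h := (hdvd (orderOf τ)).1 (by rw [zpow_natCast, pow_orderOf_eq_one]; rfl)
    rw [h0, Nat.cast_zero, zero_dvd_iff, Nat.cast_eq_zero] at h
    exact (orderOf_pos τ).ne' h
  have hinj : Set.InjOn (fun k : ℕ => (τ ^ (k : ℤ)) y) (Finset.range N : Set ℕ) := by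
    intro a ha b hb hab
    simp only [Finset.coe_range, Set.mem_Iio] at ha hb
    have h := Int.eq_zero_of_abs_lt_dvd ((heq a b).1 hab) (by rw [abs_lt]; omega)
    omega
  have hmem (z : S) : z ∈ c ↔ ∃ k < N, (τ ^ (k : ℤ)) y = z := by
    rw [hc, mem_orbit_closure_pair_iff hσ hρ hy]
    constructor
    · rintro ⟨k, rfl⟩
      have h₁ := Int.emod_nonneg k (Int.natCast_ne_zero.2 hpos.ne')
      have h₂ := Int.emod_lt_of_pos k (Int.natCast_pos.2 hpos)
      refine ⟨(k % N).toNat, by omega, ?_⟩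
      rw [Int.toNat_of_nonneg h₁, heq]
      exact Int.dvd_self_sub_emod
    · rintro ⟨k, -, rfl⟩
      exact ⟨k, rfl⟩
  have hcard (π : Equiv.Perm S) (a : ℕ) (hπ : ∀ k : ℤ, π ((τ ^ k) y) = (τ ^ (-k - a)) y) :
      {z ∈ c | π z = z}.ncard = ((Finset.range N).filter fun k => N ∣ 2 * k + a).card := by
    have himage : {z ∈ c | π z = z} = (fun k : ℕ => (τ ^ (k : ℤ)) y) ''
        ((Finset.range N).filter fun k => N ∣ 2 * k + a : Finset ℕ) := by
      have hfix (k : ℕ) : π ((τ ^ (k : ℤ)) y) = (τ ^ (k : ℤ)) y ↔ N ∣ 2 * k + a := by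
        rw [hπ, heq, ← Int.natCast_dvd_natCast]
        have : (k : ℤ) - (-k - a) = ((2 * k + a : ℕ) : ℤ) := by push_cast; ring
        rw [this]
      ext z
      simp only [Set.mem_ofPred_eq, Set.mem_image, Finset.coe_filter, Finset.mem_range, hmem]
      constructor
      · rintro ⟨⟨k, hk, rfl⟩, h⟩
        exact ⟨k, ⟨hk, (hfix k).1 h⟩, rfl⟩
      · rintro ⟨k, ⟨hk, h⟩, rfl⟩
        exact ⟨⟨k, hk, rfl⟩, (hfix k).2 h⟩
    rw [himage, (hinj.mono (Finset.coe_subset.2 (Finset.filter_subset _ _))).ncard_image, Set.ncard_coe_finset]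
  rw [hcard σ 0 (by simpa using involution_mul_zpow_apply hσ hρ hy),
    hcard ρ 1 (by simpa using involution_mul_zpow_apply' hσ hρ hy)]
  exact card_dvd_two_mul_add_card_dvd_two_mul_add_one hpos

end Involutions

/-- For two involutions `σ, ρ` of a finite set and an orbit `c` of the
subgroup they generate, the number of fixed points of `σ` in `c` plus the number of
fixed points of `ρ` in `c` is either `0` or `2`. -/
theorem stmt7 {S : Type*} [Fintype S] (σ ρ : Equiv.Perm S)
    (hσ : σ * σ = 1) (hρ : ρ * ρ = 1) (x : S) (c : Set S)
    (hc : c = MulAction.orbit ↥(Subgroup.closure ({σ, ρ} : Set (Equiv.Perm S))) x) :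
    {y ∈ c | σ y = y}.ncard + {y ∈ c | ρ y = y}.ncard = 0 ∨
      {y ∈ c | σ y = y}.ncard + {y ∈ c | ρ y = y}.ncard = 2 := by
  have horbit : ∀ y ∈ c,
      c = MulAction.orbit ↥(Subgroup.closure ({σ, ρ} : Set (Equiv.Perm S))) y := by
    intro y hy
    rw [hc] at hy ⊢
    exact (MulAction.orbit_eq_iff.2 hy).symm
  by_cases h₁ : ∃ y ∈ c, σ y = y
  · obtain ⟨y, hyc, hy⟩ := h₁
    exact Or.inr (ncard_fixed_add_ncard_fixed_of_fixed hσ hρ hy (horbit y hyc))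
  by_cases h₂ : ∃ y ∈ c, ρ y = y
  · obtain ⟨y, hyc, hy⟩ := h₂
    have hc' := horbit y hyc
    rw [Set.pair_comm] at hc'
    rw [add_comm]
    exact Or.inr (ncard_fixed_add_ncard_fixed_of_fixed hρ hσ hy hc')
  · left
    have e₁ : {y ∈ c | σ y = y} = ∅ := Set.eq_empty_of_forall_notMem fun y hy => h₁ ⟨y, hy⟩
    have e₂ : {y ∈ c | ρ y = y} = ∅ := Set.eq_empty_of_forall_notMem fun y hy => h₂ ⟨y, hy⟩
    rw [e₁, e₂, Set.ncard_empty]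
end

section
/- Let τ be a square-tiled surface on {1,…,n} and let c be an {R,G}-component of τ which is a fusion path, meaning: c is a path (τ_R and τ_G have exactly two fixed points in total in c), and for every {G,B}-component h of τ, the intersection c ∩ h is either empty, or (when h is a {G,B}-cycle) a two-element set {x, τ_G(x)} with τ_G(x) ≠ x, or (when h is a {G,B}-path) a single point fixed by τ_G. Let U be the union of all {G,B}-components of τ that meet c. Then in each of the square-tiled surfaces Shear_{c,R,G}(τ) and Shear_{c,G,R}(τ), the set U is a single {G,B}-component. -/
/-- The orbit of `x` under the group generated by `a` and `b`. -/
abbrev pairOrbit {α : Type*} (a b : Equiv.Perm α) (x : α) : Set α :=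
  MulAction.orbit ↥(Subgroup.closure ({a, b} : Set (Equiv.Perm α))) x

section PairOrbit

variable {α : Type*} {a b : Equiv.Perm α} {x y : α}

theorem left_mem_pairOrbit (h : y ∈ pairOrbit a b x) : a y ∈ pairOrbit a b x := by
  obtain ⟨p, rfl⟩ := h
  exact ⟨⟨a, Subgroup.subset_closure (by simp)⟩ * p, rfl⟩

theorem right_mem_pairOrbit (h : y ∈ pairOrbit a b x) : b y ∈ pairOrbit a b x := by
  obtain ⟨p, rfl⟩ := h
  exact ⟨⟨b, Subgroup.subset_closure (by simp)⟩ * p, rfl⟩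

theorem pairOrbit_subset [Finite α] {S : Set α} (ha : ∀ z ∈ S, a z ∈ S) (hb : ∀ z ∈ S, b z ∈ S)
    (hx : x ∈ S) : pairOrbit a b x ⊆ S := by
  rintro _ ⟨⟨p, hp⟩, rfl⟩
  change p x ∈ S
  induction hp using Subgroup.closure_induction generalizing x with
  | mem p hp =>
    rcases hp with rfl | rfl
    exacts [ha _ hx, hb _ hx]
  | one => exact hx
  | mul p q _ _ ihp ihq => exact ihp (ihq hx)
  | inv p _ ih =>
    obtain ⟨z, hz, rfl⟩ := ((S.toFinite.injOn_iff_bijOn_of_mapsTo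
      (fun z (hz : z ∈ S) => ih hz)).1 p.injective.injOn).surjOn hx
    simpa using hz

theorem pairOrbit_eq (h : y ∈ pairOrbit a b x) : pairOrbit a b y = pairOrbit a b x :=
  MulAction.orbit_eq_iff.2 h

theorem mem_pairOrbit_comm : y ∈ pairOrbit a b x ↔ x ∈ pairOrbit a b y :=
  MulAction.mem_orbit_symm

end PairOrbit

theorem even_card_of_involution {α : Type*} (S : Finset α) (f : α → α)
    (hf : ∀ z ∈ S, f (f z) = z) (hS : ∀ z ∈ S, f z ∈ S) (hne : ∀ z ∈ S, f z ≠ z) :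
    Even S.card := by
  have h : ∑ _z ∈ S, (1 : ZMod 2) = 0 :=
    Finset.sum_involution (fun z _ => f z) (fun _ _ => by decide) (fun z hz _ => hne z hz)
      hS hf
  rw [Finset.sum_const, nsmul_one] at h
  exact (ZMod.natCast_eq_zero_iff_even).1 h

/-- The points reachable from `x` by applying `b` anywhere and `g` outside of `c`. -/
def reachOff {α : Type*} (g b : Equiv.Perm α) (c : Set α) (x : α) : Set α :=
  ⋂₀ {T | x ∈ T ∧ (∀ z ∈ T, b z ∈ T) ∧ ∀ z ∈ T, z ∉ c → g z ∈ T}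

section ReachOff

variable {α : Type*} {g b : Equiv.Perm α} {c : Set α} {x y : α}

theorem self_mem_reachOff : x ∈ reachOff g b c x := fun _ hT => hT.1

theorem right_mem_reachOff (h : y ∈ reachOff g b c x) : b y ∈ reachOff g b c x :=
  fun T hT => hT.2.1 _ (h T hT)

theorem left_mem_reachOff (h : y ∈ reachOff g b c x) (hy : y ∉ c) : g y ∈ reachOff g b c x :=
  fun T hT => hT.2.2 _ (h T hT) hy

theorem reachOff_subset_pairOrbit {g' : Equiv.Perm α} (hg' : ∀ z ∉ c, g' z = g z) :
    reachOff g b c x ⊆ pairOrbit g' b x := fun _ hy =>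
  hy _ ⟨MulAction.mem_orbit_self x, fun _ => right_mem_pairOrbit,
    fun z hz hzc => hg' z hzc ▸ left_mem_pairOrbit hz⟩

theorem exists_mem_inter_reachOff [Finite α] (h : (c ∩ pairOrbit g b x).Nonempty) :
    (c ∩ reachOff g b c x).Nonempty := by
  by_contra hne
  have hdisj : ∀ z ∈ reachOff g b c x, z ∉ c := fun z hz hzc => hne ⟨z, hzc, hz⟩
  obtain ⟨z, hzc, hz⟩ := h
  exact hdisj z (pairOrbit_subset (fun z hz => left_mem_reachOff hz (hdisj z hz))
    (fun z => right_mem_reachOff) self_mem_reachOff hz) hzc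

/-- Removing one `g`-edge from a `{g,b}`-cycle does not disconnect its endpoints. -/
theorem apply_mem_reachOff [Finite α] (hg : ∀ z, g (g z) = z) (hb : ∀ z, b (b z) = z)
    (hgf : ∀ z ∈ pairOrbit g b x, g z ≠ z) (hbf : ∀ z ∈ pairOrbit g b x, b z ≠ z)
    (hc : c ∩ pairOrbit g b x = {x, g x}) : g x ∈ reachOff g b c x := by
  classical
  by_contra hgx
  have := Fintype.ofFinite α
  set S := (reachOff g b c x).toFinset
  have hmem : ∀ z, z ∈ S ↔ z ∈ reachOff g b c x := fun z => Set.mem_toFinset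
  have hsub : ∀ z ∈ S, z ∈ pairOrbit g b x := fun z hz =>
    reachOff_subset_pairOrbit (fun _ _ => rfl) ((hmem z).1 hz)
  have hxS : x ∈ S := (hmem x).2 self_mem_reachOff
  have h₁ : Even S.card := even_card_of_involution S b (fun z _ => hb z)
    (fun z hz => (hmem _).2 (right_mem_reachOff ((hmem z).1 hz))) (fun z hz => hbf z (hsub z hz))
  have hne : ∀ z ∈ S, z ≠ g x := by
    rintro z hz rfl
    exact hgx ((hmem _).1 hz)
  have h₂ : Even (S.erase x).card := by
    refine even_card_of_involution _ g (fun z _ => hg z) (fun z hz => ?_)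
      (fun z hz => hgf z (hsub z (Finset.mem_of_mem_erase hz)))
    obtain ⟨hzx, hzS⟩ := Finset.mem_erase.1 hz
    have hzc : z ∉ c := fun hzc => by
      have : z ∈ ({x, g x} : Set α) := hc ▸ ⟨hzc, hsub z hzS⟩
      exact this.elim hzx (hne z hzS)
    refine Finset.mem_erase.2 ⟨fun h => hne z hzS ?_,
      (hmem _).2 (left_mem_reachOff ((hmem z).1 hzS) hzc)⟩
    rw [← h, hg]
  have := Finset.card_erase_add_one hxS
  grind

end ReachOff

/-- Replacing `g` on a fusion component `c` by `g'`, where `g'` connects each point of `c`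
to its `r`-neighbour up to applying `g`, merges all the `{g,b}`-orbits meeting `c`. -/
theorem pairOrbit_fusion {α : Type*} [Finite α] {r g b g' : Equiv.Perm α} {x₀ : α} {c : Set α}
    (hc : c = pairOrbit r g x₀) (hg : ∀ z, g (g z) = z) (hb : ∀ z, b (b z) = z)
    (hcycle : ∀ x ∈ c, g x ≠ x → c ∩ pairOrbit g b x = {x, g x} ∧
      (∀ z ∈ pairOrbit g b x, g z ≠ z) ∧ ∀ z ∈ pairOrbit g b x, b z ≠ z)
    (hoff : ∀ z ∉ c, g' z = g z)
    (hon : (∀ z ∈ c, g' z = r z) ∨ ∀ z ∈ c, g' z = g (r (g z))) :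
    {y | (c ∩ pairOrbit g b y).Nonempty} = pairOrbit g' b x₀ := by
  have hcr : ∀ z ∈ c, r z ∈ c := by rw [hc]; exact fun z => left_mem_pairOrbit
  have hcg : ∀ z ∈ c, g z ∈ c := by rw [hc]; exact fun z => right_mem_pairOrbit
  have hx₀ : x₀ ∈ c := hc ▸ MulAction.mem_orbit_self x₀
  have hcg' : ∀ z ∈ c, g' z ∈ c := fun z hz => by
    rcases hon with h | h <;> rw [h z hz]
    exacts [hcr z hz, hcg _ (hcr _ (hcg z hz))]
  have hgO : ∀ z ∈ c, ∀ {w}, z ∈ pairOrbit g' b w → g z ∈ pairOrbit g' b w := by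
    intro z hz w hw
    by_cases hgz : g z = z
    · rwa [hgz]
    · obtain ⟨h₁, h₂, h₃⟩ := hcycle z hz hgz
      rw [← pairOrbit_eq hw]
      exact reachOff_subset_pairOrbit hoff (apply_mem_reachOff hg hb h₂ h₃ h₁)
  have hrO : ∀ z ∈ c, z ∈ pairOrbit g' b x₀ → r z ∈ pairOrbit g' b x₀ := by
    intro z hz hzO
    rcases hon with h | h
    · exact h z hz ▸ left_mem_pairOrbit hzO
    · have h₁ := left_mem_pairOrbit (hgO z hz hzO)
      rw [h _ (hcg z hz), hg] at h₁
      simpa only [hg] using hgO _ (hcg _ (hcr z hz)) h₁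
  have hcO : c ⊆ pairOrbit g' b x₀ := by
    have : pairOrbit r g x₀ ⊆ c ∩ pairOrbit g' b x₀ :=
      pairOrbit_subset (fun z hz => ⟨hcr z hz.1, hrO z hz.1 hz.2⟩)
        (fun z hz => ⟨hcg z hz.1, hgO z hz.1 hz.2⟩) ⟨hx₀, MulAction.mem_orbit_self x₀⟩
    exact hc ▸ fun z hz => (this hz).2
  have hcU : ∀ z ∈ c, (c ∩ pairOrbit g b z).Nonempty := fun z hz =>
    ⟨z, hz, MulAction.mem_orbit_self z⟩
  apply subset_antisymm
  · intro y hy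
    obtain ⟨z, hzc, hz⟩ := exists_mem_inter_reachOff hy
    rw [← pairOrbit_eq (hcO hzc), mem_pairOrbit_comm]
    exact reachOff_subset_pairOrbit hoff hz
  · refine pairOrbit_subset (fun z hz => ?_) (fun z hz => ?_) (hcU x₀ hx₀)
    · by_cases hzc : z ∈ c
      · exact hcU _ (hcg' z hzc)
      · rw [hoff z hzc, Set.mem_ofPred_eq,
          pairOrbit_eq (left_mem_pairOrbit (MulAction.mem_orbit_self z))]
        exact hz
    · rw [Set.mem_ofPred_eq, pairOrbit_eq (right_mem_pairOrbit (MulAction.mem_orbit_self z))]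
      exact hz

/-- Shearing along a fusion path merges all the horizontal
(`{G,B}`) components it meets into a single one. -/
theorem stmt9 (n : ℕ) (τ : Surf n) (hτ : IsSTS n τ)
    (c : Set (Fin n)) (hc : IsComponent n τ Color.R Color.G c)
    (hpath : {x ∈ c | τ Color.R x = x}.ncard + {x ∈ c | τ Color.G x = x}.ncard = 2)
    (hfusion : ∀ h : Set (Fin n), IsComponent n τ Color.G Color.B h →
      (c ∩ h = ∅) ∨
      ({x ∈ h | τ Color.G x = x}.ncard + {x ∈ h | τ Color.B x = x}.ncard = 0 ∧
        ∃ x, τ Color.G x ≠ x ∧ c ∩ h = {x, τ Color.G x}) ∨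
      ({x ∈ h | τ Color.G x = x}.ncard + {x ∈ h | τ Color.B x = x}.ncard = 2 ∧
        ∃ x, τ Color.G x = x ∧ c ∩ h = {x}))
    (U : Set (Fin n))
    (hU : U = {y | ∃ h : Set (Fin n),
      IsComponent n τ Color.G Color.B h ∧ (c ∩ h).Nonempty ∧ y ∈ h}) :
    IsComponent n (shear τ Color.R Color.G c) Color.G Color.B U ∧
      IsComponent n (shear τ Color.G Color.R c) Color.G Color.B U := by
  obtain ⟨-, hinv, -⟩ := hτ
  have hinv' : ∀ X z, τ X (τ X z) = z := fun X z => Equiv.Perm.congr_fun (hinv X) z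
  obtain ⟨x₀, hc⟩ := hc
  have hcR : ∀ z, τ Color.R z ∈ c ↔ z ∈ c := by
    have : ∀ z ∈ c, τ Color.R z ∈ c := by rw [hc]; exact fun z => left_mem_pairOrbit
    exact fun z => ⟨fun h => hinv' Color.R z ▸ this _ h, this z⟩
  have hcG : ∀ z, τ Color.G z ∈ c ↔ z ∈ c := by
    have : ∀ z ∈ c, τ Color.G z ∈ c := by rw [hc]; exact fun z => right_mem_pairOrbit
    exact fun z => ⟨fun h => hinv' Color.G z ▸ this _ h, this z⟩
  have hcycle : ∀ x ∈ c, τ Color.G x ≠ x →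
      c ∩ pairOrbit (τ Color.G) (τ Color.B) x = {x, τ Color.G x} ∧
      (∀ z ∈ pairOrbit (τ Color.G) (τ Color.B) x, τ Color.G z ≠ z) ∧
      ∀ z ∈ pairOrbit (τ Color.G) (τ Color.B) x, τ Color.B z ≠ z := by
    intro x hx hgx
    have hxx : x ∈ c ∩ pairOrbit (τ Color.G) (τ Color.B) x := ⟨hx, MulAction.mem_orbit_self x⟩
    rcases hfusion _ ⟨x, rfl⟩ with h | ⟨h, y, -, hy⟩ | ⟨-, y, hgy, hy⟩
    · exact absurd h (Set.Nonempty.ne_empty ⟨x, hxx⟩)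
    · obtain ⟨h₁, h₂⟩ := Nat.add_eq_zero_iff.1 h
      rw [Set.ncard_eq_zero] at h₁ h₂
      refine ⟨?_, fun z hz hzf => h₁.subset ⟨hz, hzf⟩, fun z hz hzf => h₂.subset ⟨hz, hzf⟩⟩
      rw [hy] at hxx ⊢
      rcases hxx with rfl | hxx
      · rfl
      · rw [Set.mem_singleton_iff.1 hxx, hinv', Set.pair_comm]
    · rw [hy] at hxx
      obtain rfl := Set.mem_singleton_iff.1 hxx
      exact absurd hgy hgx
  have hU' : U = {y | (c ∩ pairOrbit (τ Color.G) (τ Color.B) y).Nonempty} := by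
    rw [hU]
    ext y
    constructor
    · rintro ⟨_, ⟨w, rfl⟩, hne, hy⟩
      rw [Set.mem_ofPred_eq, pairOrbit_eq hy]
      exact hne
    · exact fun hy => ⟨_, ⟨y, rfl⟩, hy, MulAction.mem_orbit_self y⟩
  constructor
  · refine ⟨x₀, hU'.trans (pairOrbit_fusion hc (hinv' _) (hinv' _) hcycle ?_ (Or.inr ?_))⟩
    · intro z hz
      simp [shear, restrictPerm_apply_of_notMem hz]
    · intro z hz
      simp [shear, restrictPerm_apply_of_mem hcG hz,
        restrictPerm_apply_of_mem hcR ((hcG z).2 hz)]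
  · refine ⟨x₀, hU'.trans (pairOrbit_fusion hc (hinv' _) (hinv' _) hcycle ?_ (Or.inl ?_))⟩
    · intro z hz
      simp [shear, restrictPerm_apply_of_notMem hz]
    · intro z hz
      simp [shear, restrictPerm_apply_of_mem hcR hz,
        restrictPerm_apply_of_mem hcG ((hcR z).2 hz), hinv']
end
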